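/- Let T be a tree containing a designated source s and terminals with priorities, in which every terminal v is joined by some path of edges of rate ≥ P(v) to a vertex u with P(u) > P(v) (or to s). If edge rates are assigned as the maximum priority over all such paths through each edge, then for every terminal v, the s–v path in the resulting tree uses only edges of rate at least P(v). -/

import Mathlib

/-- Feasibility of the parallel PST algorithm.  `G` is a tree containing the source
`s` and the terminals `T`.  Each terminal `v` is joined by a path `p v` (with all its
edges of rate at least `P v`) to a vertex `u v` which is either `s` or a terminal of
strictly larger priority, and the tree is the union of these paths.  The rate of each
edge is the maximum (supremum) priority over all terminals whose path uses that edge.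
Then for every terminal `v`, the `s`–`v` path in the tree uses only edges of rate at
least `P v`. -/
theorem stmt_17 {V : Type*} (G : SimpleGraph V) (hG : G.IsTree)
    (s : V) (T : Finset V) (P : V → ℝ) (R : Sym2 V → ℝ)
    (u : V → V) (p : (v : V) → G.Walk v (u v))
    (hpath : ∀ v ∈ T, (p v).IsPath)
    (hup : ∀ v ∈ T, u v = s ∨ (u v ∈ T ∧ P v < P (u v)))
    (hunion : ∀ e ∈ G.edgeSet, ∃ v ∈ T, e ∈ (p v).edges)
    (hR : ∀ e : Sym2 V, R e = sSup {x : ℝ | ∃ v ∈ T, e ∈ (p v).edges ∧ x = P v}) :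
    ∀ v ∈ T, ∀ (q : G.Walk s v), q.IsPath → ∀ e ∈ q.edges, P v ≤ R e := by 
  classical
  have key : ∀ n : ℕ, ∀ v ∈ T, (T.filter (fun w => P v < P w)).card = n →
      ∃ w : G.Walk v s, ∀ e ∈ w.edges, P v ≤ R e := by
    intro n
    induction n using Nat.strong_induction_on with
    | _ n ih =>
      intro v hv hn
      have hp : ∀ e ∈ (p v).edges, P v ≤ R e := by
        intro e he
        rw [hR e]
        apply le_csSup
        · refine Set.Finite.bddAbove ((T.finite_toSet.image P).subset ?_)
          rintro x ⟨w, hw, _, rfl⟩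
          exact ⟨w, hw, rfl⟩
        · exact ⟨v, hv, he, rfl⟩
      rcases hup v hv with h | ⟨hT, hlt⟩
      · refine ⟨(p v).copy rfl h, ?_⟩
        intro e he
        rw [SimpleGraph.Walk.edges_copy] at he
        exact hp e he
      · have hc : (T.filter (fun w => P (u v) < P w)).card < n := by
          rw [← hn]
          apply Finset.card_lt_card
          rw [Finset.ssubset_iff_of_subset]
          · exact ⟨u v, by simp [hT, hlt], by simp⟩
          · intro x hx
            simp only [Finset.mem_filter] at hx ⊢
            exact ⟨hx.1, hlt.trans hx.2⟩
        obtain ⟨w, hw⟩ := ih _ hc (u v) hT rfl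
        refine ⟨(p v).append w, ?_⟩
        intro e he
        rw [SimpleGraph.Walk.edges_append, List.mem_append] at he
        rcases he with he | he
        · exact hp e he
        · exact hlt.le.trans (hw e he)
  intro v hv q hq e he
  obtain ⟨w, hw⟩ := key _ v hv rfl
  have h := hG.IsAcyclic.path_unique ⟨q.reverse, hq.reverse⟩ w.toPath
  have h2 : q.reverse = w.bypass := congrArg Subtype.val h
  apply hw
  apply SimpleGraph.Walk.edges_bypass_subset w
  rw [← h2]
  simpa using he
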